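/- arXiv:1207.1824 — 2 statements merged into one kernel-verified Lean document; each statement's English description precedes it below -/
import Mathlib

section
/- For every repeated coloring C in d dimensions, d ≤ 2·r(C)² − r(C). -/
open Function

section Lattice

variable {ι : Type*} [Fintype ι] [DecidableEq ι]

/-- A two-coloring of the lattice `ℤ^ι`: `false` = red, `true` = blue. -/
def sensAt (C : (ι → ℤ) → Bool) (x : ι → ℤ) : ℕ :=
  (Finset.univ.filter fun p : ι × Bool =>
    C (Function.update x p.1 (x p.1 + if p.2 then 1 else -1)) ≠ C x).card

/-- The axis-sensitivity of `C` at the point `x`: the number of coordinate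
directions along which some neighbor of `x` has a different color. -/
def axisSensAt (C : (ι → ℤ) → Bool) (x : ι → ℤ) : ℕ :=
  (Finset.univ.filter fun i : ι =>
    C (Function.update x i (x i + 1)) ≠ C x ∨
      C (Function.update x i (x i - 1)) ≠ C x).card

/-- The sensitivity `s(C)` of a coloring: the maximum of `s(C,x)` over all `x`. -/
noncomputable def sensSup (C : (ι → ℤ) → Bool) : ℕ := sSup (Set.range (sensAt C))

/-- The axis-sensitivity `r(C)` of a coloring: the maximum of `r(C,x)` over all `x`. -/
noncomputable def axisSensSup (C : (ι → ℤ) → Bool) : ℕ := sSup (Set.range (axisSensAt C))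

/-- The red sensitivity `s^R(C)`: maximum axis-sensitivity over red points. -/
noncomputable def redSens (C : (ι → ℤ) → Bool) : ℕ := sSup (axisSensAt C '' {x | C x = false})

/-- The blue sensitivity `s^B(C)`: maximum axis-sensitivity over blue points. -/
noncomputable def blueSens (C : (ι → ℤ) → Bool) : ℕ := sSup (axisSensAt C '' {x | C x = true})

/-- A coloring is non-trivial if the origin is red and each axis carries a blue point. -/
def NontrivialColoring (C : (ι → ℤ) → Bool) : Prop :=
  C (fun _ => 0) = false ∧
    ∀ i : ι, ∃ m : ℤ, C (Function.update (fun _ => 0) i m) = true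

/-- `y` is a neighbor of `x`: they differ by `±1` in exactly one coordinate. -/
def IsNeighbor (x y : ι → ℤ) : Prop :=
  ∃ i : ι, y = Function.update x i (x i + 1) ∨ y = Function.update x i (x i - 1)

/-- `k` is the min-width of `C`: the least positive integer such that on every axis
there is a blue point within distance `k` of the origin. -/
def MinWidth (C : (ι → ℤ) → Bool) (k : ℕ) : Prop :=
  IsLeast {w : ℕ | 0 < w ∧ ∀ i : ι, ∃ m : ℤ, |m| ≤ (w : ℤ) ∧
    C (Function.update (fun _ => 0) i m) = true} k

end Lattice

section Repeated

/-- `C` is a repeated coloring in `nk` dimensions built from `C'`: `C'` is a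
non-trivial coloring of `ℤ^k` with red sensitivity `1`, and a point `x` is blue
in `C` iff some block `x_i` of `x` is blue in `C'`. -/
def IsRepeatedColoring (n k : ℕ) (C : (Fin n × Fin k → ℤ) → Bool)
    (C' : (Fin k → ℤ) → Bool) : Prop :=
  NontrivialColoring C' ∧ redSens C' = 1 ∧
    ∀ x : Fin n × Fin k → ℤ, C x = true ↔ ∃ i : Fin n, C' (fun j => x (i, j)) = true

end Repeated

section Lattice

variable {ι : Type*} [DecidableEq ι]

/-- A neighbor of `x` along the coordinate direction `i` has a different color. -/
def SensitiveAlong (C : (ι → ℤ) → Bool) (x : ι → ℤ) (i : ι) : Prop :=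
  ∃ ε : ℤ, (ε = 1 ∨ ε = -1) ∧ C (update x i (x i + ε)) ≠ C x

/-- Every red point has blue neighbors along at most one coordinate direction. -/
def RedSensitiveAtMostOnce (C : (ι → ℤ) → Bool) : Prop :=
  ∀ x, C x = false → ∀ i j, SensitiveAlong C x i → SensitiveAlong C x j → i = j

/-- The whole line through `x` in direction `i` is blue. -/
def BlueLine (C : (ι → ℤ) → Bool) (x : ι → ℤ) (i : ι) : Prop :=
  ∀ t : ℤ, C (update x i t) = true

theorem line_induction {P : (ι → ℤ) → Prop} {l : ι}
    (hstep : ∀ x, P x → ∀ ε : ℤ, ε = 1 ∨ ε = -1 → P (update x l (x l + ε)))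
    {q : ι → ℤ} (hq : P q) (t : ℤ) : P (update q l t) := by
  induction t using Int.inductionOn' (b := q l) with
  | zero => simpa using hq
  | succ t _ ih => simpa using hstep _ ih 1 (Or.inl rfl)
  | pred t _ ih => simpa [sub_eq_add_neg] using hstep _ ih (-1) (Or.inr rfl)

theorem RedSensitiveAtMostOnce.blue_of_corner {C : (ι → ℤ) → Bool}
    (hC : RedSensitiveAtMostOnce C) {x : ι → ℤ} {i j : ι} (hij : i ≠ j) {ε δ : ℤ}
    (hε : ε = 1 ∨ ε = -1) (hδ : δ = 1 ∨ δ = -1)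
    (hi : C (update x i (x i + ε)) = true) (hj : C (update x j (x j + δ)) = true) :
    C (update (update x i (x i + ε)) j (x j + δ)) = true := by
  by_contra hred
  rw [Bool.not_eq_true] at hred
  refine hij (hC _ hred i j ⟨-ε, by omega, ?_⟩ ⟨-δ, by omega, ?_⟩)
  · rw [hred, update_of_ne hij, update_self, update_comm hij, update_idem]
    simpa [update_eq_self_iff.2, hij] using hj
  · rw [hred, update_self, update_idem]
    simpa [update_eq_self_iff.2, hij.symm] using hi

theorem RedSensitiveAtMostOnce.blueLine_step {C : (ι → ℤ) → Bool}
    (hC : RedSensitiveAtMostOnce C) {x : ι → ℤ} {j l : ι} {ε : ℤ} (hε : ε = 1 ∨ ε = -1)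
    (hy : C (update x l (x l + ε)) = true) (hx : BlueLine C x j) :
    BlueLine C (update x l (x l + ε)) j := by
  rcases eq_or_ne l j with rfl | hlj
  · intro t
    rw [update_idem]
    exact hx t
  intro t
  rw [update_comm hlj]
  have key := line_induction (l := j) (q := x)
    (P := fun z => (∃ s, z = update x j s) ∧ C (update z l (x l + ε)) = true) ?_
    ⟨⟨x j, by simp⟩, hy⟩ t
  · exact key.2
  rintro z ⟨⟨s, rfl⟩, hz⟩ δ hδ
  refine ⟨⟨s + δ, by simp⟩, ?_⟩
  have h := hC.blue_of_corner (x := update x j s) hlj hε hδ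
    (by simpa [hlj] using hz) (by simpa using hx (s + δ))
  rw [update_comm hlj] at h
  simpa [hlj] using h

theorem RedSensitiveAtMostOnce.sensitiveAlong_step {C : (ι → ℤ) → Bool}
    (hC : RedSensitiveAtMostOnce C) {x : ι → ℤ} {j l : ι} (hlj : l ≠ j) {ε : ℤ}
    (hε : ε = 1 ∨ ε = -1) (hx : C x = true) (hy : C (update x l (x l + ε)) = true)
    (hs : SensitiveAlong C x j) : SensitiveAlong C (update x l (x l + ε)) j := by
  obtain ⟨δ, hδ, h⟩ := hs
  refine ⟨δ, hδ, fun hblue => h ?_⟩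
  rw [hy] at hblue
  rw [hx]
  have := hC.blue_of_corner (x := update x l (x l + ε)) (i := l) (j := j) hlj
    (ε := -ε) (by omega) hδ (by simpa using hx) hblue
  simpa [hlj.symm] using this

/-- From a blue point one can walk through blue points to a blue point that is sensitive along
every direction whose line through the starting point is not entirely blue. -/
theorem RedSensitiveAtMostOnce.exists_sensitive_point {C : (ι → ℤ) → Bool}
    (hC : RedSensitiveAtMostOnce C) {p : ι → ℤ} (hp : C p = true) {D : Finset ι}
    (hD : ∀ j ∈ D, ¬ BlueLine C p j) :
    ∃ q, C q = true ∧ ∀ j ∈ D, SensitiveAlong C q j := by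
  suffices ∀ S ⊆ D, ∃ q, C q = true ∧ (∀ j ∈ D, ¬ BlueLine C q j) ∧
      ∀ j ∈ S, SensitiveAlong C q j by
    obtain ⟨q, hq, -, h⟩ := this D subset_rfl
    exact ⟨q, hq, h⟩
  intro S
  induction S using Finset.induction_on with
  | empty => exact fun _ => ⟨p, hp, hD, by simp⟩
  | insert l S hl ih =>
    intro hS
    obtain ⟨q, hq, hqD, hqS⟩ := ih fun j hj => hS (Finset.mem_insert_of_mem hj)
    by_contra hno
    refine hqD l (hS (Finset.mem_insert_self _ _)) fun t => ?_
    refine (line_induction (P := fun z => C z = true ∧ (∀ j ∈ D, ¬ BlueLine C z j) ∧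
      ∀ j ∈ S, SensitiveAlong C z j) ?_ ⟨hq, hqD, hqS⟩ t).1
    rintro z ⟨hz, hzD, hzS⟩ ε hε
    have hz' : C (update z l (z l + ε)) = true := by
      by_contra hne
      refine hno ⟨z, hz, hzD, fun j hj => ?_⟩
      rcases Finset.mem_insert.1 hj with rfl | hj
      · exact ⟨ε, hε, by rwa [hz]⟩
      · exact hzS j hj
    refine ⟨hz', fun j hj hline => hzD j hj ?_, fun j hj =>
      hC.sensitiveAlong_step (ne_of_mem_of_not_mem hj hl).symm hε hz hz' (hzS j hj)⟩
    have := hC.blueLine_step (x := update z l (z l + ε)) (l := l) (ε := -ε) (by omega)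
      (by simpa using hz) hline
    simpa using this

theorem RedSensitiveAtMostOnce.not_blueLine_or {C : (ι → ℤ) → Bool}
    (hC : RedSensitiveAtMostOnce C) (h0 : C (fun _ => 0) = false) {i j : ι} (hij : i ≠ j)
    (a b : ℤ) : ¬ BlueLine C (update (fun _ => 0) i a) j ∨
      ¬ BlueLine C (update (fun _ => 0) j b) i := by
  by_contra! h
  obtain ⟨hi, hj⟩ := h
  have key := line_induction (l := j) (q := update (update (fun _ => 0) i a) j b)
    (P := fun z => (∃ s, z = update (update (fun _ => 0) i a) j s) ∧ BlueLine C z i) ?_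
    ⟨⟨b, rfl⟩, fun t => ?_⟩ 0
  · have := key.2 0
    rw [update_idem, update_comm hij.symm, update_idem] at this
    simp only [update_eq_self_iff.2 rfl] at this
    simp [h0] at this
  · rintro z ⟨⟨s, rfl⟩, hz⟩ ε hε
    refine ⟨⟨s + ε, by simp⟩, hC.blueLine_step hε ?_ hz⟩
    simpa using hi (s + ε)
  · rw [update_comm hij, update_idem]
    exact hj t

variable [Fintype ι]

theorem axisSensAt_le_card (C : (ι → ℤ) → Bool) (x : ι → ℤ) :
    axisSensAt C x ≤ Fintype.card ι :=
  Finset.card_le_univ _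

theorem axisSensAt_le_axisSensSup (C : (ι → ℤ) → Bool) (x : ι → ℤ) :
    axisSensAt C x ≤ axisSensSup C :=
  le_csSup ⟨Fintype.card ι, by rintro _ ⟨y, rfl⟩; exact axisSensAt_le_card C y⟩ ⟨x, rfl⟩

theorem axisSensAt_le_redSens {C : (ι → ℤ) → Bool} {x : ι → ℤ} (hx : C x = false) :
    axisSensAt C x ≤ redSens C :=
  le_csSup ⟨Fintype.card ι, by rintro _ ⟨y, -, rfl⟩; exact axisSensAt_le_card C y⟩ ⟨x, hx, rfl⟩

theorem sensitiveAlong_iff {C : (ι → ℤ) → Bool} {x : ι → ℤ} {i : ι} :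
    SensitiveAlong C x i ↔ i ∈ Finset.univ.filter fun i : ι =>
      C (update x i (x i + 1)) ≠ C x ∨ C (update x i (x i - 1)) ≠ C x := by
  simp [SensitiveAlong, or_and_right, exists_or, sub_eq_add_neg]

theorem card_le_axisSensAt {C : (ι → ℤ) → Bool} {x : ι → ℤ} {D : Finset ι}
    (hD : ∀ i ∈ D, SensitiveAlong C x i) : D.card ≤ axisSensAt C x :=
  Finset.card_le_card fun i hi => sensitiveAlong_iff.1 (hD i hi)

theorem redSensitiveAtMostOnce_of_redSens_le_one {C : (ι → ℤ) → Bool} (h : redSens C ≤ 1) :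
    RedSensitiveAtMostOnce C := fun _ hx i j hi hj =>
  Finset.card_le_one.1 ((axisSensAt_le_redSens hx).trans h) i (sensitiveAlong_iff.1 hi) j
    (sensitiveAlong_iff.1 hj)

theorem exists_card_lt_two_mul_card_filter [Nonempty ι] (R : ι → ι → Prop)
    [∀ i, DecidablePred (R i)] (hrefl : ∀ i, R i i) (htotal : ∀ i j, i ≠ j → R i j ∨ R j i) :
    ∃ i, Fintype.card ι < 2 * (Finset.univ.filter (R i)).card := by
  by_contra! hle
  have hcount (i j : ι) :
      1 + (if i = j then 1 else 0) ≤ (if R i j then 1 else 0) + (if R j i then 1 else 0) := by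
    by_cases hij : i = j
    · subst hij
      simp [hrefl]
    · rcases htotal i j hij with h | h <;> simp [hij, h]
  have hsum := Finset.sum_le_sum fun i (_ : i ∈ Finset.univ) =>
    Finset.sum_le_sum fun j (_ : j ∈ Finset.univ) => hcount i j
  simp only [Finset.sum_add_distrib] at hsum
  rw [Finset.sum_comm (f := fun i j => if R j i then 1 else 0)] at hsum
  have hupper := Finset.sum_le_sum fun i (_ : i ∈ Finset.univ) => hle i
  simp only [← Finset.mul_sum, Finset.card_filter] at hupper
  simp at hsum hupper
  have := Fintype.card_pos (α := ι)
  omega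

/-- A non-trivial coloring with red sensitivity at most one has a blue point that is sensitive
along more than half of the directions. -/
theorem NontrivialColoring.exists_blue_card_lt [Nonempty ι] {C : (ι → ℤ) → Bool}
    (h : NontrivialColoring C) (hred : redSens C ≤ 1) :
    ∃ q, C q = true ∧ ∃ D : Finset ι, (∀ j ∈ D, SensitiveAlong C q j) ∧
      Fintype.card ι < 2 * D.card := by
  classical
  have hC := redSensitiveAtMostOnce_of_redSens_le_one hred
  obtain ⟨h0, hblue⟩ := h
  choose a ha using hblue
  obtain ⟨i, hi⟩ := exists_card_lt_two_mul_card_filter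
    (fun i j => ¬ BlueLine C (update (fun _ => 0) i (a i)) j)
    (fun i hline => by
      have := hline 0
      rw [update_idem, update_eq_self_iff.2 rfl, h0] at this
      contradiction)
    (fun i j hij => hC.not_blueLine_or h0 hij (a i) (a j))
  obtain ⟨q, hq, hqD⟩ := hC.exists_sensitive_point (ha i)
    (D := Finset.univ.filter fun j => ¬ BlueLine C (update (fun _ => 0) i (a i)) j)
    (fun j hj => (Finset.mem_filter.1 hj).2)
  exact ⟨q, hq, _, hqD, hi⟩

end Lattice

theorem block_update {n k : ℕ} (x : Fin n × Fin k → ℤ) (i b : Fin n) (l : Fin k) (v : ℤ) :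
    (fun j => update x (i, l) v (b, j)) =
      if b = i then update (fun j => x (i, j)) l v else fun j => x (b, j) := by
  split_ifs with h
  · subst h
    ext j
    simp [update_apply]
  · ext j
    simp [h]

theorem IsRepeatedColoring.le_axisSensSup {n k : ℕ} {C : (Fin n × Fin k → ℤ) → Bool}
    {C' : (Fin k → ℤ) → Bool} (h : IsRepeatedColoring n k C C') : n ≤ axisSensSup C := by
  obtain ⟨⟨h0, -⟩, hred, hC⟩ := h
  obtain ⟨y, hy, hy1⟩ : 1 ∈ axisSensAt C' '' {x | C' x = false} := by
    rw [← hred]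
    exact Nat.sSup_mem ⟨_, _, h0, rfl⟩
      ⟨Fintype.card (Fin k), by rintro _ ⟨y, -, rfl⟩; exact axisSensAt_le_card C' y⟩
  obtain ⟨l, hl⟩ := Finset.card_pos.1 (hy1.symm ▸ one_pos : 0 < axisSensAt C' y)
  obtain ⟨ε, hε, hne⟩ := sensitiveAlong_iff.2 hl
  have hy : C' y = false := hy
  rw [hy, ne_eq, Bool.not_eq_false] at hne
  have hx : C (fun p => y p.2) = false := by
    rw [← Bool.not_eq_true, hC]
    simp [hy]
  have hcard := card_le_axisSensAt (C := C) (x := fun p => y p.2)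
    (D := Finset.univ.image fun b : Fin n => (b, l)) fun p hp => by
      obtain ⟨b, -, rfl⟩ := Finset.mem_image.1 hp
      refine ⟨ε, hε, ?_⟩
      rw [hx, ne_eq, Bool.not_eq_false, hC]
      refine ⟨b, ?_⟩
      rw [block_update]
      simpa using hne
  rw [Finset.card_image_of_injective _ fun _ _ hab => (Prod.ext_iff.1 hab).1] at hcard
  simpa using hcard.trans (axisSensAt_le_axisSensSup C _)

theorem IsRepeatedColoring.card_le_axisSensSup {n k : ℕ} {C : (Fin n × Fin k → ℤ) → Bool}
    {C' : (Fin k → ℤ) → Bool} (h : IsRepeatedColoring n k C C') (i : Fin n) {q : Fin k → ℤ}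
    (hq : C' q = true) {D : Finset (Fin k)} (hD : ∀ j ∈ D, SensitiveAlong C' q j) :
    D.card ≤ axisSensSup C := by
  obtain ⟨⟨h0, -⟩, -, hC⟩ := h
  let x : Fin n × Fin k → ℤ := fun p => if p.1 = i then q p.2 else 0
  have hx : C x = true := (hC x).2 ⟨i, by simpa [x] using hq⟩
  have hcard := card_le_axisSensAt (C := C) (x := x) (D := D.image fun j => (i, j)) fun p hp => by
    obtain ⟨l, hl, rfl⟩ := Finset.mem_image.1 hp
    obtain ⟨ε, hε, hne⟩ := hD l hl
    refine ⟨ε, hε, ?_⟩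
    rw [hx, ne_eq, hC]
    rintro ⟨b, hb⟩
    rw [block_update] at hb
    by_cases hbi : b = i
    · rw [hq] at hne
      exact hne (by simpa [hbi, x] using hb)
    · simp [hbi, x, h0] at hb
  rw [Finset.card_image_of_injective _ fun _ _ hab => (Prod.ext_iff.1 hab).2] at hcard
  exact hcard.trans (axisSensAt_le_axisSensSup C _)

/-- For every repeated coloring `C` in `d = nk` dimensions,
`d ≤ 2·r(C)² - r(C)`. -/
theorem repeated_dimension_bound_axisSens (n k : ℕ) (C : (Fin n × Fin k → ℤ) → Bool)
    (C' : (Fin k → ℤ) → Bool) (h : IsRepeatedColoring n k C C') :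
    n * k ≤ 2 * (axisSensSup C) ^ 2 - axisSensSup C := by
  rcases n.eq_zero_or_pos with rfl | hn
  · simp
  rcases k.eq_zero_or_pos with rfl | hk
  · simp
  have : Nonempty (Fin k) := ⟨⟨0, hk⟩⟩
  obtain ⟨q, hq, D, hD, hlt⟩ := h.1.exists_blue_card_lt h.2.1.le
  have hDr := h.card_le_axisSensSup ⟨0, hn⟩ hq hD
  have hnr := h.le_axisSensSup
  rw [Fintype.card_fin] at hlt
  apply Nat.le_sub_of_add_le
  nlinarith
end

section
/- If C is a non-trivial two-coloring of ℤ^d with s(C) < d, then C has infinitely many red points and infinitely many blue points. -/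
open Function

theorem sensAt_le_sensSup {ι : Type*} [Fintype ι] [DecidableEq ι] (C : (ι → ℤ) → Bool)
    (x : ι → ℤ) : sensAt C x ≤ sensSup C :=
  le_csSup ⟨Fintype.card (ι × Bool), by rintro _ ⟨y, rfl⟩; exact Finset.card_le_univ _⟩ ⟨x, rfl⟩

/-- A finite nonempty color class contains a point whose sensitivity is at least the dimension:
the point with the largest coordinate sum. -/
theorem card_le_sensSup_of_finite {ι : Type*} [Fintype ι] [DecidableEq ι] (C : (ι → ℤ) → Bool)
    (b : Bool) (hfin : {x | C x = b}.Finite) (hne : {x | C x = b}.Nonempty) :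
    Fintype.card ι ≤ sensSup C := by
  obtain ⟨x, hx, hmax⟩ := Set.exists_max_image _ (fun x : ι → ℤ => ∑ i, x i) hfin hne
  have hx' : C x = b := hx
  refine le_trans ?_ (sensAt_le_sensSup C x)
  have hinj : Injective (fun i : ι => (i, true)) := fun i j h => congrArg Prod.fst h
  rw [← Finset.card_univ, ← Finset.card_image_of_injective _ hinj]
  refine Finset.card_le_card fun p hp => ?_
  obtain ⟨i, -, rfl⟩ := Finset.mem_image.1 hp
  refine Finset.mem_filter.2 ⟨Finset.mem_univ _, fun h => ?_⟩
  have hle := hmax _ (h.trans hx')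
  have hsum := Finset.add_sum_erase Finset.univ x (Finset.mem_univ i)
  simp only [if_true, Finset.sum_update_of_mem (Finset.mem_univ i),
    Finset.sdiff_singleton_eq_erase] at hle
  linarith

/-- A non-trivial coloring of `ℤ^d` with `s(C) < d` has infinitely many
red points and infinitely many blue points. -/
theorem infinite_red_blue_of_sens_lt (d : ℕ) (C : (Fin d → ℤ) → Bool)
    (hC : NontrivialColoring C) (hs : sensSup C < d) :
    {x : Fin d → ℤ | C x = false}.Infinite ∧ {x : Fin d → ℤ | C x = true}.Infinite := by
  have key (b : Bool) (hne : {x | C x = b}.Nonempty) : {x | C x = b}.Infinite := fun hfin =>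
    absurd (card_le_sensSup_of_finite C b hfin hne) (by simpa using hs)
  obtain ⟨m, hm⟩ := hC.2 ⟨0, Nat.zero_lt_of_lt hs⟩
  exact ⟨key false ⟨_, hC.1⟩, key true ⟨_, hm⟩⟩
end
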